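/- Let μ be a finite real Radon measure on ℝ² and let μ_pp be its atomic part. For every p ∈ (1,∞], limsup_{t→0⁺} (4πt)^{1−1/p} ‖e^{tΔ}μ‖_{L^p(ℝ²)} ≤ ‖μ_pp‖_tv. -/

import Mathlib

open MeasureTheory Filter Real
open scoped ENNReal Topology

noncomputable section

abbrev R2 := EuclideanSpace ℝ (Fin 2)

/-- Heat kernel on `ℝ²`. -/
def heatKernel (t : ℝ) (x : R2) : ℝ := (4 * π * t)⁻¹ * Real.exp (-‖x‖ ^ 2 / (4 * t))

/-- Total variation norm of a finite signed measure. -/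
def tvNorm (μ : SignedMeasure R2) : ℝ≥0∞ := μ.totalVariation Set.univ

/-- Integral of a function against a signed measure. -/
def sIntegral (μ : SignedMeasure R2) (f : R2 → ℝ) : ℝ :=
  (∫ x, f x ∂μ.toJordanDecomposition.posPart) - ∫ x, f x ∂μ.toJordanDecomposition.negPart

/-- Heat extension `e^{tΔ}μ` of a signed measure. -/
def heatExt (μ : SignedMeasure R2) (t : ℝ) (x : R2) : ℝ :=
  sIntegral μ (fun y => heatKernel t (x - y))

/-- Atomic (pure point) part of a signed measure: the restriction of `μ` to its
set of atoms. -/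
def atomicPart (μ : SignedMeasure R2) : SignedMeasure R2 :=
  μ.restrict {x | μ {x} ≠ 0}

/-- Small balls have uniformly small mass for a finite atomless measure. -/
theorem exists_forall_measure_ball_le {X : Type*} [MetricSpace X] [MeasurableSpace X]
    [BorelSpace X] (ν : Measure X) [IsFiniteMeasure ν] [ν.InnerRegularCompactLTTop] [NullSingletonClass ν]
    {ε : ℝ≥0∞} (hε : 0 < ε) : ∃ r > 0, ∀ x, ν (Metric.ball x r) ≤ ε := by
  obtain ⟨K, -, hK, hKε⟩ := MeasurableSet.univ.exists_isCompact_sdiff_lt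
    (measure_ne_top ν Set.univ) hε.ne'
  have hsmall (y : X) : ∃ r > 0, ν (Metric.ball y r) < ε := by
    have h := tendsto_measure_thickening_of_isClosed (μ := ν) (s := {y})
      ⟨1, one_pos, measure_ne_top _ _⟩ isClosed_singleton
    rw [measure_singleton] at h
    obtain ⟨r, hr, hr0⟩ := ((h.eventually (gt_mem_nhds hε)).and self_mem_nhdsWithin).exists
    exact ⟨r, hr0, by simpa [Metric.thickening_singleton] using hr⟩
  choose r hr0 hr using hsmall
  obtain ⟨δ, hδ, h⟩ := lebesgue_number_lemma_of_metric hK (c := fun y => Metric.ball y (r y))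
    (fun _ => Metric.isOpen_ball)
    (fun y _ => Set.mem_iUnion.2 ⟨y, Metric.mem_ball_self (hr0 y)⟩)
  refine ⟨δ / 2, half_pos hδ, fun x => ?_⟩
  by_cases hx : (Metric.ball x (δ / 2) ∩ K).Nonempty
  · obtain ⟨z, hzx, hzK⟩ := hx
    obtain ⟨y, hy⟩ := h z hzK
    refine (measure_mono ((Metric.ball_subset_ball' ?_).trans hy)).trans (hr y).le
    rw [Metric.mem_ball'] at hzx
    linarith
  · have hsub : Metric.ball x (δ / 2) ⊆ Set.univ \ K :=
      fun z hz => ⟨Set.mem_univ z, fun hzK => hx ⟨z, hz, hzK⟩⟩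
    exact (measure_mono hsub).trans hKε.le

/-- Interpolation between `L¹` and `L^∞` bounds. -/
theorem eLpNorm_le_rpow_mul_rpow {X : Type*} [MeasurableSpace X] {ν : Measure X} {f : X → ℝ≥0∞}
    {A M p : ℝ≥0∞} (hp : 1 ≤ p) (hA : ∫⁻ x, f x ∂ν ≤ A) (hM : ∀ x, f x ≤ M) (hf : Measurable f) :
    eLpNorm f p ν ≤ A ^ (1 / p).toReal * M ^ (1 - 1 / p).toReal := by
  by_cases hp_top : p = ∞
  · subst hp_top
    simpa using eLpNormEssSup_le_of_ae_enorm_bound (ae_of_all ν hM)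
  have hp0 : p ≠ 0 := (zero_lt_one.trans_le hp).ne'
  have hp1 : 1 ≤ p.toReal := by
    rwa [← ENNReal.toReal_one, ENNReal.toReal_le_toReal ENNReal.one_ne_top hp_top]
  have hq : (1 / p).toReal = 1 / p.toReal := by simp
  have hq' : (1 - 1 / p).toReal = (p.toReal - 1) * (1 / p.toReal) := by
    rw [ENNReal.toReal_sub_of_le (by simpa using hp) ENNReal.one_ne_top, hq, ENNReal.toReal_one]
    field_simp
  rw [eLpNorm_eq_lintegral_rpow_enorm_toReal hp0 hp_top, hq, hq', ENNReal.rpow_mul,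
    ← ENNReal.mul_rpow_of_nonneg _ _ (by positivity)]
  gcongr
  calc ∫⁻ x, ‖f x‖ₑ ^ p.toReal ∂ν
    _ ≤ ∫⁻ x, f x * M ^ (p.toReal - 1) ∂ν := by
        refine lintegral_mono fun x => ?_
        rw [enorm_eq_self, ← add_sub_cancel 1 p.toReal,
          ENNReal.rpow_add_of_nonneg _ _ zero_le_one (by linarith), ENNReal.rpow_one,
          add_sub_cancel]
        gcongr
        · exact hM x
    _ ≤ A * M ^ (p.toReal - 1) := by
        rw [lintegral_mul_const _ hf]
        gcongr

theorem totalVariation_singleton_eq_zero {X : Type*} [MeasurableSpace X]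
    [MeasurableSingletonClass X] (μ : SignedMeasure X) {x : X} (hx : μ {x} = 0) :
    μ.totalVariation {x} = 0 := by
  have h := μ.apply_eq_posPart_real_sub_negPart_real (measurableSet_singleton x)
  rw [hx] at h
  have h' : μ.toJordanDecomposition.posPart {x} = μ.toJordanDecomposition.negPart {x} := by
    rw [← ENNReal.toReal_eq_toReal_iff' (measure_ne_top _ _) (measure_ne_top _ _)]
    exact (sub_eq_zero.1 h.symm)
  obtain ⟨s, -, h1, h2⟩ := μ.toJordanDecomposition.mutuallySingular
  rw [SignedMeasure.totalVariation, Measure.add_apply]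
  by_cases hxs : x ∈ s
  · have := measure_mono_null (Set.singleton_subset_iff.2 hxs) h1
    rw [← h', this, add_zero]
  · have := measure_mono_null (Set.singleton_subset_iff.2 (Set.mem_compl hxs)) h2
    rw [h', this, add_zero]

theorem countable_atoms {X : Type*} [MeasurableSpace X] [MeasurableSingletonClass X]
    (μ : SignedMeasure X) : {x | μ {x} ≠ 0}.Countable := by
  refine (Measure.countable_meas_pos_of_disjoint_iUnion (μ := μ.totalVariation)
    (As := fun x : X => {x}) (fun x => measurableSet_singleton x)
    (fun x y hxy => Set.disjoint_singleton.2 hxy)).mono fun x hx => ?_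
  exact pos_iff_ne_zero.2 fun h => hx (μ.null_of_totalVariation_zero h)

theorem measurable_heatKernel (t : ℝ) : Measurable (heatKernel t) := by
  unfold heatKernel
  fun_prop

theorem heatKernel_nonneg {t : ℝ} (ht : 0 < t) (x : R2) : 0 ≤ heatKernel t x := by
  unfold heatKernel
  positivity

theorem lintegral_heatKernel {t : ℝ} (ht : 0 < t) :
    ∫⁻ x, ENNReal.ofReal (heatKernel t x) = 1 := by
  have h : ∫ x, heatKernel t x = 1 := by
    have hg := GaussianFourier.integral_rexp_neg_mul_sq_norm (V := R2)
      (b := (4 * t)⁻¹) (by positivity)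
    have he (x : R2) : -‖x‖ ^ 2 / (4 * t) = -(4 * t)⁻¹ * ‖x‖ ^ 2 := by ring
    simp only [heatKernel, he]
    rw [integral_const_mul, hg]
    simp
    field_simp
  rw [← ofReal_integral_eq_lintegral_ofReal (Integrable.of_integral_ne_zero (by simp [h]))
    (ae_of_all _ (heatKernel_nonneg ht)), h, ENNReal.ofReal_one]

/-- The heat extension of a positive measure, with values in `ℝ≥0∞`. -/
def lheatExt (ν : Measure R2) (t : ℝ) (x : R2) : ℝ≥0∞ :=
  ∫⁻ y, ENNReal.ofReal (heatKernel t (x - y)) ∂ν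

theorem measurable_uncurry_heatKernel (t : ℝ) :
    Measurable (Function.uncurry fun x y : R2 => ENNReal.ofReal (heatKernel t (x - y))) :=
  ((measurable_heatKernel t).comp measurable_sub).ennreal_ofReal

theorem measurable_lheatExt (ν : Measure R2) [SFinite ν] (t : ℝ) : Measurable (lheatExt ν t) :=
  (measurable_uncurry_heatKernel t).lintegral_prod_right'

theorem lintegral_lheatExt (ν : Measure R2) [SFinite ν] {t : ℝ} (ht : 0 < t) :
    ∫⁻ x, lheatExt ν t x = ν Set.univ := by
  unfold lheatExt
  rw [lintegral_lintegral_swap (measurable_uncurry_heatKernel t).aemeasurable]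
  have h (y : R2) : ∫⁻ x, ENNReal.ofReal (heatKernel t (x - y)) = 1 := by
    rw [lintegral_sub_right_eq_self (fun x => ENNReal.ofReal (heatKernel t x)),
      lintegral_heatKernel ht]
  simp [h]

theorem enorm_heatExt_le (μ : SignedMeasure R2) {t : ℝ} (ht : 0 < t) (x : R2) :
    ‖heatExt μ t x‖ₑ ≤ lheatExt μ.totalVariation t x := by
  have h (ν : Measure R2) : ‖∫ y, heatKernel t (x - y) ∂ν‖ₑ ≤ lheatExt ν t x := by
    refine (enorm_integral_le_lintegral_enorm _).trans_eq (lintegral_congr fun y => ?_)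
    exact Real.enorm_of_nonneg (heatKernel_nonneg ht _)
  rw [lheatExt, SignedMeasure.totalVariation, lintegral_add_measure]
  exact (enorm_sub_le).trans (add_le_add (h _) (h _))

/-- The Gaussian average of `ν`, that is `4πt` times its heat extension. -/
def gaussAverage (ν : Measure R2) (t : ℝ) (x : R2) : ℝ≥0∞ :=
  ∫⁻ y, ENNReal.ofReal (Real.exp (-‖x - y‖ ^ 2 / (4 * t))) ∂ν

theorem lheatExt_eq (ν : Measure R2) {t : ℝ} (ht : 0 < t) (x : R2) :
    lheatExt ν t x = (ENNReal.ofReal (4 * π * t))⁻¹ * gaussAverage ν t x := by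
  unfold lheatExt gaussAverage heatKernel
  rw [← lintegral_const_mul _ (by fun_prop), ← ENNReal.ofReal_inv_of_pos (by positivity)]
  simp_rw [ENNReal.ofReal_mul (show 0 ≤ (4 * π * t)⁻¹ by positivity)]

theorem gaussAverage_le (ν : Measure R2) {t : ℝ} (ht : 0 < t) (x : R2) :
    gaussAverage ν t x ≤ ν Set.univ := by
  rw [← lintegral_one]
  refine lintegral_mono fun y => ?_
  rw [ENNReal.ofReal_le_one, Real.exp_le_one_iff, neg_div]
  exact neg_nonpos.2 (by positivity)

theorem rpow_mul_eLpNorm_lheatExt_le (ν : Measure R2) [SFinite ν] {t : ℝ} (ht : 0 < t)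
    {p N : ℝ≥0∞} (hp : 1 ≤ p) (hN : ∀ x, gaussAverage ν t x ≤ N) :
    ENNReal.ofReal ((4 * π * t) ^ (1 - 1 / p).toReal) * eLpNorm (lheatExt ν t) p volume ≤
      ν Set.univ ^ (1 / p).toReal * N ^ (1 - 1 / p).toReal := by
  have hs : 0 < 4 * π * t := by positivity
  have h := eLpNorm_le_rpow_mul_rpow hp (lintegral_lheatExt ν ht).le
    (M := (ENNReal.ofReal (4 * π * t))⁻¹ * N)
    (fun x => by rw [lheatExt_eq ν ht]; gcongr; exact hN x) (measurable_lheatExt ν t)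
  refine (mul_le_mul_right h _).trans_eq ?_
  rw [← ENNReal.ofReal_rpow_of_pos hs, mul_left_comm,
    ← ENNReal.mul_rpow_of_nonneg _ _ ENNReal.toReal_nonneg, ← mul_assoc,
    ENNReal.mul_inv_cancel (by simpa using hs) ENNReal.ofReal_ne_top, one_mul]

theorem tendsto_iSup_gaussAverage (ν : Measure R2) [IsFiniteMeasure ν] [NullSingletonClass ν] :
    Tendsto (fun t => ⨆ x, gaussAverage ν t x) (𝓝[>] 0) (𝓝 0) := by
  rw [ENNReal.tendsto_nhds_zero]
  intro ε hε
  obtain ⟨r, hr, hball⟩ := exists_forall_measure_ball_le ν (ENNReal.half_pos hε.ne')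
  have htail : Tendsto (fun t : ℝ => ENNReal.ofReal (Real.exp (-r ^ 2 / (4 * t))) * ν Set.univ)
      (𝓝[>] 0) (𝓝 0) := by
    have h1 : Tendsto (fun t : ℝ => -r ^ 2 / (4 * t)) (𝓝[>] 0) atBot := by
      have := tendsto_inv_nhdsGT_zero (𝕜 := ℝ).const_mul_atTop_of_neg
        (show -r ^ 2 / 4 < 0 by rw [neg_div]; exact neg_lt_zero.2 (by positivity))
      refine this.congr fun t => ?_
      ring
    have h2 := ENNReal.tendsto_ofReal (Real.tendsto_exp_atBot.comp h1)
    simpa using ENNReal.Tendsto.mul_const h2 (Or.inr (measure_ne_top ν Set.univ))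
  filter_upwards [(ENNReal.tendsto_nhds_zero.1 htail) (ε / 2) (ENNReal.half_pos hε.ne'),
    self_mem_nhdsWithin] with t ht ht0
  have ht0 : 0 < t := ht0
  refine iSup_le fun x => ?_
  calc gaussAverage ν t x
    _ ≤ ∫⁻ y, ((Metric.ball x r).indicator 1 y
          + ENNReal.ofReal (Real.exp (-r ^ 2 / (4 * t)))) ∂ν := by
        refine lintegral_mono fun y => ?_
        by_cases hy : y ∈ Metric.ball x r
        · rw [Set.indicator_of_mem hy]
          refine le_add_right ?_
          rw [Pi.one_apply, ENNReal.ofReal_le_one, Real.exp_le_one_iff, neg_div]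
          exact neg_nonpos.2 (by positivity)
        · refine le_add_left (ENNReal.ofReal_le_ofReal ?_)
          rw [Metric.mem_ball', not_lt, dist_eq_norm] at hy
          gcongr
    _ = ν (Metric.ball x r) + ENNReal.ofReal (Real.exp (-r ^ 2 / (4 * t))) * ν Set.univ := by
        rw [lintegral_add_right _ measurable_const, lintegral_indicator_one measurableSet_ball,
          lintegral_const]
    _ ≤ ε / 2 + ε / 2 := add_le_add (hball x) ht
    _ = ε := ENNReal.add_halves ε

/-- For every `p ∈ (1,∞]`,
`limsup_{t→0⁺} (4πt)^{1-1/p} ‖e^{tΔ}μ‖_{L^p} ≤ ‖μ_pp‖_tv`. -/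
theorem heatExt_limsup_le_atomic (μ : SignedMeasure R2) (p : ℝ≥0∞) (hp : 1 < p) :
    Filter.limsup
      (fun t : ℝ =>
        ENNReal.ofReal ((4 * π * t) ^ (1 - 1/p).toReal) * eLpNorm (heatExt μ t) p volume)
      (𝓝[>] (0 : ℝ)) ≤ tvNorm (atomicPart μ) := by
  set S : Set R2 := {x | μ {x} ≠ 0}
  have hSm : MeasurableSet S := (countable_atoms μ).measurableSet
  set a := μ.totalVariation.restrict S
  set c := μ.totalVariation.restrict Sᶜ
  have htv : tvNorm (atomicPart μ) = a Set.univ := by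
    rw [tvNorm, atomicPart, SignedMeasure.totalVariation_eq_variation,
      VectorMeasure.variation_restrict hSm, ← SignedMeasure.totalVariation_eq_variation]
  have hc : NullSingletonClass c := by
    refine ⟨fun x => ?_⟩
    rw [Measure.restrict_apply (measurableSet_singleton x)]
    by_cases hx : μ {x} = 0
    · exact measure_mono_null Set.inter_subset_left (totalVariation_singleton_eq_zero μ hx)
    · rw [Set.singleton_inter_eq_empty.2 (not_not.2 hx), measure_empty]
  have hθ : 0 < (1 - 1 / p).toReal := by
    refine ENNReal.toReal_pos (tsub_pos_iff_lt.2 ?_).ne' (ENNReal.sub_ne_top ENNReal.one_ne_top)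
    simpa using hp
  have hbound : Tendsto (fun t => a Set.univ + c Set.univ ^ (1 / p).toReal *
      (⨆ x, gaussAverage c t x) ^ (1 - 1 / p).toReal) (𝓝[>] 0) (𝓝 (a Set.univ)) := by
    have h := (ENNReal.continuous_rpow_const (y := (1 - 1 / p).toReal)).tendsto 0
    rw [ENNReal.zero_rpow_of_pos hθ] at h
    have h' := ENNReal.Tendsto.const_mul (h.comp (tendsto_iSup_gaussAverage c))
      (Or.inr (ENNReal.rpow_ne_top_of_nonneg ENNReal.toReal_nonneg (measure_ne_top c Set.univ))
        : (0 : ℝ≥0∞) ≠ 0 ∨ c Set.univ ^ (1 / p).toReal ≠ ∞)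
    simpa using h'.const_add (a Set.univ)
  rw [htv, ← hbound.limsup_eq]
  refine limsup_le_limsup ?_
  filter_upwards [self_mem_nhdsWithin] with t ht
  have ht : 0 < t := ht
  have hle : eLpNorm (heatExt μ t) p volume ≤
      eLpNorm (lheatExt a t) p volume + eLpNorm (lheatExt c t) p volume := by
    refine le_trans (eLpNorm_mono_enorm fun x => ?_) (eLpNorm_add_le
      (measurable_lheatExt a t).aestronglyMeasurable
      (measurable_lheatExt c t).aestronglyMeasurable hp.le)
    refine (enorm_heatExt_le μ ht x).trans_eq ?_
    rw [enorm_eq_self, Pi.add_apply, lheatExt, lheatExt, lheatExt, ← lintegral_add_measure,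
      Measure.restrict_add_restrict_compl hSm]
  refine (mul_le_mul_right hle _).trans ?_
  rw [mul_add]
  refine add_le_add ?_ (rpow_mul_eLpNorm_lheatExt_le c ht hp.le fun x => le_iSup _ x)
  refine (rpow_mul_eLpNorm_lheatExt_le a ht hp.le (gaussAverage_le a ht)).trans_eq ?_
  rw [← ENNReal.rpow_add_of_nonneg _ _ ENNReal.toReal_nonneg ENNReal.toReal_nonneg,
    ← ENNReal.toReal_add (by simpa using (zero_lt_one.trans hp).ne')
      (ENNReal.sub_ne_top ENNReal.one_ne_top),
    add_tsub_cancel_of_le (by simpa using hp.le), ENNReal.toReal_one, ENNReal.rpow_one]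

end
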